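/- arXiv:2501.03660 — 3 statements merged into one kernel-verified Lean document; each statement's English description precedes it below -/
import Mathlib

section
/- Let p be a prime and let M₁, M₂ be p×p matrices over ℤ/pℤ with M₁M₂ − M₂M₁ = I such that the only subspaces of (ℤ/pℤ)^p invariant under both M₁ and M₂ are 0 and the whole space. Then there exist an invertible matrix C over ℤ/pℤ and elements μ, λ ∈ ℤ/pℤ such that C⁻¹M₁C = M_a(μ) and C⁻¹M₂C = M_b(λ), where M_a(μ) is the p×p matrix with entries 1 in positions (i+1,i) for 1 ≤ i ≤ p−1, entry μ in position (1,p), and 0 elsewhere, and M_b(λ) is the p×p matrix with all diagonal entries equal to λ, entry p−i in position (i,i+1) for 1 ≤ i ≤ p−1, and 0 elsewhere. -/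
/-- The `p×p` matrix `M_a(μ)`: entries `1` in positions `(i+1, i)` for
`1 ≤ i ≤ p−1` (1-indexed), entry `μ` in position `(1, p)`, and `0` elsewhere. -/
def Ma (p : ℕ) (μ : ZMod p) : Matrix (Fin p) (Fin p) (ZMod p) :=
  Matrix.of fun i j =>
    if (i : ℕ) = (j : ℕ) + 1 then 1 else if (i : ℕ) = 0 ∧ (j : ℕ) = p - 1 then μ else 0

/-- The `p×p` matrix `M_b(λ)`: all diagonal entries `λ`, entry `p − i` in position
`(i, i+1)` for `1 ≤ i ≤ p−1` (1-indexed), and `0` elsewhere. -/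
def Mb (p : ℕ) (lam : ZMod p) : Matrix (Fin p) (Fin p) (ZMod p) :=
  Matrix.of fun i j =>
    if (i : ℕ) = (j : ℕ) then lam
    else if (j : ℕ) = (i : ℕ) + 1 then ((p - ((i : ℕ) + 1) : ℕ) : ZMod p) else 0

open Module

theorem exists_eq_algebraMap_of_commute {K V : Type*} [Field K] [Finite K] [AddCommGroup V]
    [Module K V] (hV : (finrank K V).Prime) {f g z : End K V} (hfg : ¬ Commute f g)
    (hirr : ∀ W : Submodule K V, (∀ v ∈ W, f v ∈ W) → (∀ v ∈ W, g v ∈ W) → W = ⊥ ∨ W = ⊤)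
    (hzf : Commute z f) (hzg : Commute z g) : ∃ c : K, z = algebraMap K (End K V) c := by
  have : Module.Finite K V := Module.finite_of_finrank_pos hV.pos
  have : Finite V := Module.finite_of_finite K
  have : Nontrivial V := Module.nontrivial_of_finrank_pos hV.pos
  let D : Subalgebra K (End K V) := Subalgebra.centralizer K {f, g}
  have hDf : ∀ d : D, Commute f d := fun d ↦ (Subalgebra.mem_centralizer_iff K).1 d.2 f (by simp)
  have hDg : ∀ d : D, Commute g d := fun d ↦ (Subalgebra.mem_centralizer_iff K).1 d.2 g (by simp)
  have hsmul : ∀ (h : End K V) (d : D) (v : V), Commute h d → h (d • v) = d • h v :=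
    fun h d v hc ↦ LinearMap.congr_fun hc.eq v
  have hinj : ∀ d : D, d ≠ 0 → ∀ v : V, d • v = 0 → v = 0 := by
    intro d hd v hv
    have hstable : ∀ h : End K V, Commute h d →
        ∀ w ∈ LinearMap.ker (d : End K V), h w ∈ LinearMap.ker (d : End K V) := by
      intro h hc w hw
      change d • w = 0 at hw
      change d • h w = 0
      rw [← hsmul h d w hc, hw, map_zero]
    rcases hirr _ (hstable f (hDf d)) (hstable g (hDg d)) with h | h
    · exact LinearMap.ker_eq_bot'.1 h v hv
    · exact absurd (Subtype.ext (LinearMap.ker_eq_top.1 h)) hd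
  have : NoZeroDivisors D := ⟨fun {a b} hab ↦ by
    by_contra! h
    exact h.2 <| Subtype.ext <| LinearMap.ext fun v ↦ hinj a h.1 _ <| by
      change a • b • v = 0
      rw [smul_smul, hab, zero_smul]⟩
  have : IsDomain D := NoZeroDivisors.to_isDomain D
  have : Finite (End K V) := Module.finite_of_finite K
  have : Finite D := Subtype.finite
  have hF : IsField D := Finite.isDomain_to_isField D
  let _ : DivisionRing D := hF.toField.toDivisionRing
  have hmul : finrank K D * finrank D V = finrank K V := Module.finrank_mul_finrank K D V
  rcases (Nat.dvd_prime hV).1 ⟨_, hmul.symm⟩ with h | h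
  · obtain ⟨c, hc⟩ := (finrank_eq_one_iff_of_nonzero' (1 : D) one_ne_zero).1 h
      ⟨z, (Subalgebra.mem_centralizer_iff K).2 (by
        rintro x (rfl | rfl)
        · exact hzf.symm.eq
        · exact hzg.symm.eq)⟩
    exact ⟨c, by rw [Algebra.algebraMap_eq_smul_one]; exact (congrArg Subtype.val hc).symm⟩
  · have h1 : finrank D V = 1 := by
      rw [h] at hmul
      exact Nat.eq_of_mul_eq_mul_left hV.pos (by rw [hmul, mul_one])
    refine absurd (LinearMap.ext fun v ↦ ?_) hfg
    by_cases hv : v = 0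
    · simp [hv]
    obtain ⟨a, ha⟩ := (finrank_eq_one_iff_of_nonzero' v hv).1 h1 (f v)
    obtain ⟨b, hb⟩ := (finrank_eq_one_iff_of_nonzero' v hv).1 h1 (g v)
    rw [End.mul_apply, End.mul_apply, ← hb, ← ha, hsmul f b v (hDf b), hsmul g a v (hDg a),
      ← ha, ← hb, smul_smul, smul_smul, hF.mul_comm]

theorem mul_pow_succ_eq_add_of_mul_sub_mul_eq_one {R : Type*} [Ring R] {a b : R}
    (h : a * b - b * a = 1) (n : ℕ) : a * b ^ (n + 1) = b ^ (n + 1) * a + (n + 1 : ℕ) * b ^ n := by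
  have hab : a * b = b * a + 1 := by rw [← h]; abel
  induction n with
  | zero => simpa using hab
  | succ n ih =>
    rw [pow_succ, ← mul_assoc, ih, add_mul, mul_assoc, hab, mul_add, ← mul_assoc, mul_assoc _ _ b,
      ← pow_succ, ← pow_succ, mul_one, Nat.cast_succ (n + 1), add_mul, one_mul]
    abel

theorem mul_pow_succ_eq_sub_of_mul_sub_mul_eq_one {R : Type*} [Ring R] {a b : R}
    (h : a * b - b * a = 1) (n : ℕ) : b * a ^ (n + 1) = a ^ (n + 1) * b - (n + 1 : ℕ) * a ^ n := by
  have := mul_pow_succ_eq_add_of_mul_sub_mul_eq_one (a := -b) (b := a)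
    (by rw [← h]; noncomm_ring) n
  rw [neg_mul, mul_neg] at this
  rw [← neg_inj, this]
  abel

theorem commute_pow_char_right_of_mul_sub_mul_eq_one {R : Type*} [Ring R] (p : ℕ) [CharP R p] {a b : R}
    (h : a * b - b * a = 1) : Commute a (b ^ p) := by
  rcases p with _ | n
  · simp
  · rw [Commute, SemiconjBy, mul_pow_succ_eq_add_of_mul_sub_mul_eq_one h, CharP.cast_eq_zero, zero_mul,
      add_zero]

theorem commute_pow_char_left_of_mul_sub_mul_eq_one {R : Type*} [Ring R] (p : ℕ) [CharP R p]
    {a b : R} (h : a * b - b * a = 1) : Commute (a ^ p) b := by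
  rcases p with _ | n
  · simp
  · rw [Commute, SemiconjBy, mul_pow_succ_eq_sub_of_mul_sub_mul_eq_one h, CharP.cast_eq_zero, zero_mul,
      sub_zero]

theorem exists_eigenvector {p : ℕ} [Fact p.Prime] {V : Type*} [AddCommGroup V]
    [Module (ZMod p) V] (hV : finrank (ZMod p) V = p) {f g : End (ZMod p) V}
    (hfg : f * g - g * f = 1)
    (hirr : ∀ W : Submodule (ZMod p) V,
      (∀ v ∈ W, f v ∈ W) → (∀ v ∈ W, g v ∈ W) → W = ⊥ ∨ W = ⊤) :
    ∃ (v : V) (μ lam : ZMod p), v ≠ 0 ∧ (f ^ p) v = μ • v ∧ g v = lam • v := by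
  have hp : p.Prime := Fact.out
  have hprime : (finrank (ZMod p) V).Prime := by rwa [hV]
  have : Nontrivial V := Module.nontrivial_of_finrank_pos hprime.pos
  have : CharP (End (ZMod p) V) p :=
    charP_of_injective_algebraMap (algebraMap (ZMod p) (End (ZMod p) V)).injective p
  have hnc : ¬ Commute f g := fun h ↦ one_ne_zero (hfg.symm.trans (sub_eq_zero.2 h.eq))
  obtain ⟨c, hc⟩ := exists_eq_algebraMap_of_commute hprime hnc hirr
    (commute_pow_char_right_of_mul_sub_mul_eq_one p hfg).symm ((Commute.refl g).pow_left p)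
  obtain ⟨μ, hμ⟩ := exists_eq_algebraMap_of_commute hprime hnc hirr
    ((Commute.refl f).pow_left p) (commute_pow_char_left_of_mul_sub_mul_eq_one p hfg)
  have hnil : (g - algebraMap _ _ c) ^ p = 0 := by
    rw [sub_pow_char_of_commute p (Algebra.commute_algebraMap_right c g), hc, ← map_pow,
      ZMod.pow_card, sub_self]
  have hker : LinearMap.ker (g - algebraMap _ _ c) ≠ ⊥ := by
    intro h
    have hinj := LinearMap.ker_eq_bot.1 h
    obtain ⟨v, hv⟩ := exists_ne (0 : V)
    have hpow : Function.Injective ⇑((g - algebraMap _ _ c) ^ p) := by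
      rw [End.coe_pow]
      exact hinj.iterate p
    exact hv (hpow (by simp [hnil]))
  obtain ⟨v, hv, hv0⟩ := Submodule.exists_mem_ne_zero_of_ne_bot hker
  refine ⟨v, μ, c, hv0, by simp [hμ], ?_⟩
  simpa [sub_eq_zero] using hv

theorem span_pow_apply_eq_top {p : ℕ} (hp : p ≠ 0) {K V : Type*} [Field K] [AddCommGroup V]
    [Module K V] {f g : End K V} (hfg : f * g - g * f = 1)
    (hirr : ∀ W : Submodule K V, (∀ v ∈ W, f v ∈ W) → (∀ v ∈ W, g v ∈ W) → W = ⊥ ∨ W = ⊤)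
    {v : V} {μ lam : K} (hv : v ≠ 0) (hf : (f ^ p) v = μ • v) (hg : g v = lam • v) :
    Submodule.span K (Set.range fun i : Fin p ↦ (f ^ (i : ℕ)) v) = ⊤ := by
  set W := Submodule.span K (Set.range fun i : Fin p ↦ (f ^ (i : ℕ)) v) with hW
  have hmem : ∀ i < p, (f ^ i) v ∈ W := fun i hi ↦ Submodule.subset_span ⟨⟨i, hi⟩, rfl⟩
  have hstable : ∀ h : End K V, (∀ i < p, h ((f ^ i) v) ∈ W) → ∀ w ∈ W, h w ∈ W := by
    intro h hh
    have : W ≤ W.comap h := by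
      rw [hW, Submodule.span_le]
      rintro _ ⟨i, rfl⟩
      exact hh i i.2
    exact this
  refine (hirr W (hstable f fun i hi ↦ ?_) (hstable g fun i hi ↦ ?_)).resolve_left ?_
  · rw [← End.mul_apply, ← pow_succ']
    rcases (Nat.succ_le_of_lt hi).lt_or_eq with h | h
    · exact hmem _ h
    · rw [← Nat.succ_eq_add_one, h, hf]
      exact W.smul_mem _ (by simpa using hmem 0 (Nat.pos_of_ne_zero hp))
  · rcases i with _ | i
    · simpa [hg] using W.smul_mem lam (hmem 0 hi)
    · rw [← End.mul_apply, mul_pow_succ_eq_sub_of_mul_sub_mul_eq_one hfg, LinearMap.sub_apply,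
        End.mul_apply, End.mul_apply, hg, map_smul, End.natCast_apply]
      exact W.sub_mem (W.smul_mem _ (hmem _ hi)) (W.nsmul_mem (hmem i (by lia)) _)
  · intro h
    have := hmem 0 (Nat.pos_of_ne_zero hp)
    rw [h] at this
    exact hv (by simpa using this)

theorem mul_Ma_apply {p : ℕ} (μ : ZMod p) (C : Matrix (Fin p) (Fin p) (ZMod p)) (x j : Fin p) :
    (C * Ma p μ) x j =
      if h : (j : ℕ) + 1 < p then C x ⟨j + 1, h⟩ else μ * C x ⟨0, j.pos⟩ := by
  rw [Matrix.mul_apply]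
  split_ifs with h
  · rw [Finset.sum_eq_single ⟨j + 1, h⟩]
    · simp [Ma]
    · intro i _ hi
      have hi' : (i : ℕ) ≠ j + 1 := fun h ↦ hi (Fin.ext h)
      simp [Ma, hi']
      lia
    · simp
  · rw [Finset.sum_eq_single ⟨0, j.pos⟩]
    · have : (j : ℕ) = p - 1 := by lia
      simp [Ma, this, mul_comm]
    · intro i _ hi
      have hi' : (i : ℕ) ≠ 0 := fun h ↦ hi (Fin.ext h)
      have hj : (i : ℕ) ≠ j + 1 := by lia
      simp [Ma, hi', hj]
    · simp

theorem mul_Mb_apply_zero {p : ℕ} (lam : ZMod p) (C : Matrix (Fin p) (Fin p) (ZMod p))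
    (x : Fin p) (h : 0 < p) : (C * Mb p lam) x ⟨0, h⟩ = lam * C x ⟨0, h⟩ := by
  rw [Matrix.mul_apply, Finset.sum_eq_single ⟨0, h⟩]
  · simp [Mb, mul_comm]
  · intro i _ hi
    have hi' : (i : ℕ) ≠ 0 := fun h ↦ hi (Fin.ext h)
    simp [Mb, hi']
  · simp

theorem mul_Mb_apply_succ {p : ℕ} (lam : ZMod p) (C : Matrix (Fin p) (Fin p) (ZMod p))
    (x : Fin p) (j : ℕ) (h : j + 1 < p) : (C * Mb p lam) x ⟨j + 1, h⟩ =
      lam * C x ⟨j + 1, h⟩ - (j + 1 : ℕ) * C x ⟨j, by lia⟩ := by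
  rw [Matrix.mul_apply, Finset.sum_eq_add (⟨j + 1, h⟩ : Fin p) ⟨j, by lia⟩]
  · simp [Mb]
    ring
  · simp
  · intro i _ hi
    have h1 : (i : ℕ) ≠ j + 1 := fun h ↦ hi.1 (Fin.ext h)
    have h2 : j ≠ i := fun h ↦ hi.2 (Fin.ext h.symm)
    simp [Mb, h1, h2]
  · simp
  · simp

/-- every irreducible `p`-dimensional representation of the first Weyl
algebra over `ℤ/pℤ` (a pair `M₁, M₂` with `M₁M₂ − M₂M₁ = I` admitting no nontrivial
common invariant subspace) is conjugate, by some invertible matrix `C`, to the pair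
`(M_a(μ), M_b(λ))` for suitable `μ, λ ∈ ℤ/pℤ`. -/
theorem stmt_17 (p : ℕ) (hp : p.Prime)
    (M₁ M₂ : Matrix (Fin p) (Fin p) (ZMod p))
    (hweyl : M₁ * M₂ - M₂ * M₁ = 1)
    (hirr : ∀ W : Submodule (ZMod p) (Fin p → ZMod p),
      (∀ v ∈ W, M₁.mulVec v ∈ W) → (∀ v ∈ W, M₂.mulVec v ∈ W) → W = ⊥ ∨ W = ⊤) :
    ∃ (C : Matrix (Fin p) (Fin p) (ZMod p)) (μ lam : ZMod p), IsUnit C ∧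
      C⁻¹ * M₁ * C = Ma p μ ∧ C⁻¹ * M₂ * C = Mb p lam := by
  have : Fact p.Prime := ⟨hp⟩
  set f : End (ZMod p) (Fin p → ZMod p) := Matrix.toLinAlgEquiv' M₁ with hf
  set g : End (ZMod p) (Fin p → ZMod p) := Matrix.toLinAlgEquiv' M₂ with hg
  have hfg : f * g - g * f = 1 := by rw [hf, hg, ← map_mul, ← map_mul, ← map_sub, hweyl, map_one]
  have hirr' : ∀ W : Submodule (ZMod p) (Fin p → ZMod p),
      (∀ v ∈ W, f v ∈ W) → (∀ v ∈ W, g v ∈ W) → W = ⊥ ∨ W = ⊤ := hirr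
  obtain ⟨v, μ, lam, hv, hfv, hgv⟩ := exists_eigenvector (by simp) hfg hirr'
  let C : Matrix (Fin p) (Fin p) (ZMod p) := Matrix.of fun x i ↦ (f ^ (i : ℕ)) v x
  have hC : IsUnit C := by
    rw [← Matrix.linearIndependent_cols_iff_isUnit]
    exact linearIndependent_of_top_le_span_of_card_eq_finrank
      (span_pow_apply_eq_top hp.ne_zero hfg hirr' hv hfv hgv).ge (by simp)
  have hdet : IsUnit C.det := (Matrix.isUnit_iff_isUnit_det C).1 hC
  have hcol : ∀ (M : Matrix (Fin p) (Fin p) (ZMod p)) (x j : Fin p),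
      (M * C) x j = (Matrix.toLinAlgEquiv' M) ((f ^ (j : ℕ)) v) x := fun _ _ _ ↦ rfl
  have h₁ : M₁ * C = C * Ma p μ := by
    ext x j
    rw [hcol, mul_Ma_apply, ← hf, ← End.mul_apply, ← pow_succ']
    split_ifs with h
    · rfl
    · have hj : (j : ℕ) + 1 = p := by lia
      simp [hj, hfv, C]
  have h₂ : M₂ * C = C * Mb p lam := by
    ext x ⟨j, hj⟩
    rw [hcol, ← hg]
    rcases j with _ | j
    · rw [mul_Mb_apply_zero]
      simp [hgv, C]
    · rw [mul_Mb_apply_succ, ← End.mul_apply, mul_pow_succ_eq_sub_of_mul_sub_mul_eq_one hfg,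
        LinearMap.sub_apply, End.mul_apply, End.mul_apply, hgv, map_smul, End.natCast_apply]
      simp [C]
  refine ⟨C, μ, lam, hC, ?_, ?_⟩
  · rw [mul_assoc, h₁, Matrix.nonsing_inv_mul_cancel_left _ _ hdet]
  · rw [mul_assoc, h₂, Matrix.nonsing_inv_mul_cancel_left _ _ hdet]
end

section
/- Let K be a field, n ≥ 1 and μ ∈ K, and let A_μ be the n×n matrix over K with entries 1 in positions (i+1,i) for 1 ≤ i ≤ n−1, entry μ in position (1,n), and 0 elsewhere. Then an n×n matrix C over K commutes with A_μ if and only if C is μ-circulant, i.e. there exist c₁,…,c_n ∈ K such that C has (i,j)-entry equal to c_{((j−i) mod n)+1} when i ≥ j and equal to μ·c_{((j−i) mod n)+1} when i < j. -/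
/-- The `n×n` matrix `A_μ` over a field `K`: entries `1` in positions `(i+1, i)` for
`1 ≤ i ≤ n−1` (1-indexed), entry `μ` in position `(1, n)`, and `0` elsewhere. -/
def Amu (n : ℕ) {K : Type*} [Field K] (μ : K) : Matrix (Fin n) (Fin n) K :=
  Matrix.of fun i j =>
    if (i : ℕ) = (j : ℕ) + 1 then 1 else if (i : ℕ) = 0 ∧ (j : ℕ) = n - 1 then μ else 0

theorem Amu_succ_apply_eq_left {K : Type*} [Field K] (m : ℕ) (μ : K) (i j : Fin (m + 1)) :
    Amu (m + 1) μ i j = if j = i - 1 then (if i = 0 then μ else 1) else 0 := by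
  have hi := i.isLt
  have hj := j.isLt
  simp only [Amu, Matrix.of_apply, Fin.ext_iff, Fin.val_zero, Fin.coe_sub_one]
  grind

theorem Amu_succ_apply_eq_right {K : Type*} [Field K] (m : ℕ) (μ : K) (i j : Fin (m + 1)) :
    Amu (m + 1) μ i j = if i = j + 1 then (if j = Fin.last m then μ else 1) else 0 := by
  have hi := i.isLt
  have hj := j.isLt
  simp only [Amu, Matrix.of_apply, Fin.ext_iff, Fin.val_add_one, Fin.val_last]
  grind

theorem mul_Amu_succ_apply {K : Type*} [Field K] (m : ℕ) (μ : K)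
    (C : Matrix (Fin (m + 1)) (Fin (m + 1)) K) (i j : Fin (m + 1)) :
    (C * Amu (m + 1) μ) i j = (if j = Fin.last m then μ else 1) * C i (j + 1) := by
  simp [Matrix.mul_apply, Amu_succ_apply_eq_right, mul_comm]

theorem Amu_succ_mul_apply {K : Type*} [Field K] (m : ℕ) (μ : K)
    (C : Matrix (Fin (m + 1)) (Fin (m + 1)) K) (i j : Fin (m + 1)) :
    (Amu (m + 1) μ * C) i j = (if i = 0 then μ else 1) * C (i - 1) j := by
  simp [Matrix.mul_apply, Amu_succ_apply_eq_left]

/-- The weight `1` on and below the diagonal, `μ` above it, is compatible with the cyclic shift. -/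
theorem circulant_weight_shift {K : Type*} [Field K] (m : ℕ) (μ : K) (i j : Fin (m + 1)) :
    (if j = Fin.last m then μ else 1) * (if ((j + 1 : Fin (m + 1)) : ℕ) ≤ i then 1 else μ) =
      (if i = 0 then μ else 1) * (if (j : ℕ) ≤ (i - 1 : Fin (m + 1)) then 1 else μ) := by
  have hi := i.isLt
  have hj := j.isLt
  simp only [Fin.ext_iff, Fin.val_add_one, Fin.val_last, Fin.coe_sub_one, Fin.val_zero]
  grind

/-- an `n×n` matrix `C` over a field `K` commutes with `A_μ` iff `C` is
`μ`-circulant: there are `c₁, …, c_n ∈ K` with `(i,j)`-entry of `C` equal to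
`c_{((j−i) mod n)+1}` when `i ≥ j` and to `μ·c_{((j−i) mod n)+1}` when `i < j`
(indices here 0-based, with `j - i` computed mod `n` in `Fin n`). -/
theorem stmt_18 {K : Type*} [Field K] (n : ℕ) (hn : 1 ≤ n) (μ : K)
    (C : Matrix (Fin n) (Fin n) K) :
    C * Amu n μ = Amu n μ * C ↔
      ∃ c : Fin n → K, ∀ i j : Fin n,
        C i j = if (j : ℕ) ≤ (i : ℕ) then c (j - i) else μ * c (j - i) := by
  obtain ⟨m, rfl⟩ : ∃ m, n = m + 1 := ⟨n - 1, by lia⟩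
  have weight (c : Fin (m + 1) → K) (i j : Fin (m + 1)) :
      (if (j : ℕ) ≤ (i : ℕ) then c (j - i) else μ * c (j - i)) =
        (if (j : ℕ) ≤ (i : ℕ) then 1 else μ) * c (j - i) := by
    split_ifs <;> simp
  have sub_shift (i j : Fin (m + 1)) : j - (i - 1) = j + 1 - i := by abel
  simp only [weight, ← Matrix.ext_iff, mul_Amu_succ_apply, Amu_succ_mul_apply]
  constructor
  · intro h
    refine ⟨fun k => C (-k) 0, fun i j => ?_⟩
    induction j using Fin.induction generalizing i with
    | zero => simp
    | succ j ih =>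
      have hstep := h i j.castSucc
      have hw := circulant_weight_shift m μ i j.castSucc
      rw [ih, ← mul_assoc, ← hw, sub_shift] at hstep
      simpa [Fin.castSucc_ne_last, Fin.coeSucc_eq_succ] using hstep
  · rintro ⟨c, hc⟩ i j
    rw [hc i, hc (i - 1), ← mul_assoc, ← mul_assoc, circulant_weight_shift, sub_shift]
end

section
/- For every prime number p, the number of isomorphism classes of finite simple latin affine non-degenerate cycle sets of cardinality p^p is exactly p(p−1). -/
/-- The permutation group `G(X)` of a left quasigroup, generated by the left translations. -/
def permGroup {X : Type*} (σ : X → Equiv.Perm X) : Subgroup (Equiv.Perm X) :=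
  Subgroup.closure (Set.range σ)

/-- The left translation `σ_x` as an element of `G(X)`. -/
def sigmaG {X : Type*} (σ : X → Equiv.Perm X) (x : X) : permGroup σ :=
  ⟨σ x, Subgroup.subset_closure ⟨x, rfl⟩⟩

/-- The displacement group `Dis(X)`: the normal closure in `G(X)` of the
elements `σ_x ∘ σ_y⁻¹`. -/
def dis {X : Type*} (σ : X → Equiv.Perm X) : Subgroup ↥(permGroup σ) :=
  Subgroup.normalClosure {g : ↥(permGroup σ) | ∃ x y : X, (g : Equiv.Perm X) = σ x * (σ y)⁻¹}

/-- A left quasigroup is indecomposable if `G(X)` acts transitively. -/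
def Indecomposable {X : Type*} (σ : X → Equiv.Perm X) : Prop :=
  ∀ x y : X, ∃ g ∈ permGroup σ, g x = y

/-- A left quasigroup is irretractable if `σ_x = σ_y` implies `x = y`. -/
def Irretractable {X : Type*} (σ : X → Equiv.Perm X) : Prop :=
  ∀ x y : X, σ x = σ y → x = y

/-- A left quasigroup is latin if every right translation is bijective. -/
def LatinLQ {X : Type*} (σ : X → Equiv.Perm X) : Prop :=
  ∀ x : X, Function.Bijective fun y => σ y x

/-- A congruence of a left quasigroup. -/
def IsCongruence {X : Type*} (σ : X → Equiv.Perm X) (r : X → X → Prop) : Prop :=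
  Equivalence r ∧
  (∀ x x' y y' : X, r x x' → r y y' → r (σ x y) (σ x' y')) ∧
  (∀ x x' y y' : X, r x x' → r y y' → r ((σ x).symm y) ((σ x').symm y'))

/-- A left quasigroup is simple if it is indecomposable and its only congruences are
the equality relation and the total relation. -/
def SimpleLQ {X : Type*} (σ : X → Equiv.Perm X) : Prop :=
  Indecomposable σ ∧ ∀ r : X → X → Prop, IsCongruence σ r →
    (∀ a b : X, r a b ↔ a = b) ∨ (∀ a b : X, r a b)

/-- The cycle set identity `(x·y)·(x·z) = (y·x)·(y·z)`. -/
def CycleSetLaw {X : Type*} (σ : X → Equiv.Perm X) : Prop :=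
  ∀ x y z : X, σ (σ x y) (σ x z) = σ (σ y x) (σ y z)

/-- Non-degeneracy: the squaring map `x ↦ x·x` is bijective. -/
def Nondeg {X : Type*} (σ : X → Equiv.Perm X) : Prop :=
  Function.Bijective fun x : X => σ x x

/-- The displacement group acts transitively. -/
def DisTransitive {X : Type*} (σ : X → Equiv.Perm X) : Prop :=
  ∀ x y : X, ∃ g ∈ dis σ, (g : Equiv.Perm X) x = y

/-- A left quasigroup is affine if there is an abelian group structure `(X,+)`,
additive automorphisms `φ, ψ` and a constant `c` with `x·y = φ(x) + ψ(y) + c`. -/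
def IsAffine {X : Type*} (σ : X → Equiv.Perm X) : Prop :=
  ∃ _inst : AddCommGroup X, ∃ φ ψ : X → X, ∃ c : X,
    Function.Bijective φ ∧ Function.Bijective ψ ∧
    (∀ a b : X, φ (a + b) = φ a + φ b) ∧ (∀ a b : X, ψ (a + b) = ψ a + ψ b) ∧
    ∀ x y : X, σ x y = φ x + ψ y + c

theorem LinearMap.eq_top_of_commutator_eq_one {K V : Type*} [Field K] [AddCommGroup V] [Module K V]
    [FiniteDimensional K V] {p : ℕ} [CharP K p] (hV : Module.finrank K V = p)
    {θ ψ : Module.End K V} (h : ψ * θ - θ * ψ = 1) {W : Submodule K V}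
    (hθ : ∀ x ∈ W, θ x ∈ W) (hψ : ∀ x ∈ W, ψ x ∈ W) (hW : W ≠ ⊥) : W = ⊤ := by
  have hr : ψ.restrict hψ * θ.restrict hθ - θ.restrict hθ * ψ.restrict hψ = 1 := by
    ext x
    simpa using LinearMap.congr_fun h (x : V)
  have ht := congrArg (LinearMap.trace K W) hr
  rw [map_sub, LinearMap.trace_mul_comm, sub_self, LinearMap.trace_one, eq_comm,
    CharP.cast_eq_zero_iff K p] at ht
  have hpos : Module.finrank K W ≠ 0 := fun h0 => hW (Submodule.finrank_eq_zero.1 h0)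
  apply Submodule.eq_top_of_finrank_eq
  exact le_antisymm W.finrank_le (hV ▸ Nat.le_of_dvd (Nat.pos_of_ne_zero hpos) ht)

theorem LinearMap.eq_smul_one_of_commutator_eq_one {K V : Type*} [Field K] [AddCommGroup V]
    [Module K V] [FiniteDimensional K V] {p : ℕ} [CharP K p] (hp : p ≠ 0)
    (hV : Module.finrank K V = p) {θ ψ z : Module.End K V} (h : ψ * θ - θ * ψ = 1)
    (hzθ : Commute z θ) (hzψ : Commute z ψ) : ∃ a : K, z = a • 1 := by
  let L := AlgebraicClosure K
  let b := Module.finBasisOfFinrankEq K V hV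
  let Ψ : Module.End K V →+* Module.End L (Fin p → L) :=
    ((Matrix.toLinAlgEquiv' : Matrix (Fin p) (Fin p) L ≃ₐ[L] _) : _ →+* _).comp
      ((algebraMap K L).mapMatrix.comp ((LinearMap.toMatrixAlgEquiv b).toRingEquiv.toRingHom))
  have hcomm : Ψ ψ * Ψ θ - Ψ θ * Ψ ψ = 1 := by
    rw [← map_mul, ← map_mul, ← map_sub, h, map_one]
  have : Nonempty (Fin p) := ⟨⟨0, Nat.pos_of_ne_zero hp⟩⟩
  obtain ⟨μ, hμ⟩ := Module.End.exists_eigenvalue (Ψ z)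
  have : CharP L p := charP_of_injective_algebraMap (algebraMap K L).injective p
  have hinv : ∀ f : Module.End K V, Commute z f →
      ∀ x ∈ (Ψ z).eigenspace μ, Ψ f x ∈ (Ψ z).eigenspace μ := by
    intro f hf x hx
    rw [Module.End.mem_eigenspace_iff] at hx ⊢
    have := LinearMap.congr_fun (hf.map Ψ).eq x
    simp only [Module.End.mul_apply] at this
    rw [this, hx, map_smul]
  have htop := LinearMap.eq_top_of_commutator_eq_one (p := p) (by simp) hcomm
    (hinv θ hzθ) (hinv ψ hzψ) hμ
  have hz : (algebraMap K L).mapMatrix (LinearMap.toMatrixAlgEquiv b z) =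
      μ • (1 : Matrix (Fin p) (Fin p) L) := by
    apply (Matrix.toLinAlgEquiv' : Matrix (Fin p) (Fin p) L ≃ₐ[L] _).injective
    rw [map_smul, map_one]
    refine LinearMap.ext fun x => ?_
    have hx : x ∈ (Ψ z).eigenspace μ := htop ▸ Submodule.mem_top
    exact Module.End.mem_eigenspace_iff.1 hx
  let i₀ : Fin p := ⟨0, Nat.pos_of_ne_zero hp⟩
  have hμ' : algebraMap K L (LinearMap.toMatrixAlgEquiv b z i₀ i₀) = μ := by
    simpa using congrFun (congrFun hz i₀) i₀
  refine ⟨LinearMap.toMatrixAlgEquiv b z i₀ i₀, ?_⟩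
  apply (LinearMap.toMatrixAlgEquiv b).injective
  rw [map_smul, map_one]
  ext i j
  apply (algebraMap K L).injective
  have := congrFun (congrFun hz i) j
  simp only [RingHom.mapMatrix_apply, Matrix.map_apply] at this
  rw [this, ← hμ']
  by_cases hij : i = j <;> simp [hij]

theorem LinearMap.pow_commutator_of_commutator_eq_one {K V : Type*} [Field K] [AddCommGroup V]
    [Module K V] {θ ψ : Module.End K V} (h : ψ * θ - θ * ψ = 1) (n : ℕ) :
    ψ * θ ^ (n + 1) - θ ^ (n + 1) * ψ = ((n + 1 : ℕ) : K) • θ ^ n := by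
  induction n with
  | zero => simpa using h
  | succ n ih =>
    have : ψ * θ ^ (n + 1 + 1) - θ ^ (n + 1 + 1) * ψ =
        (ψ * θ ^ (n + 1) - θ ^ (n + 1) * ψ) * θ + θ ^ (n + 1) * (ψ * θ - θ * ψ) := by
      rw [pow_succ θ (n + 1)]; noncomm_ring
    rw [this, ih, h, smul_mul_assoc, ← pow_succ, mul_one, Nat.cast_succ (n + 1), add_smul, one_smul]

theorem LinearMap.commute_pow_char_of_commutator_eq_one {K V : Type*} [Field K] [AddCommGroup V]
    [Module K V] {p : ℕ} [CharP K p] (hp : p ≠ 0) {θ ψ : Module.End K V}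
    (h : ψ * θ - θ * ψ = 1) : Commute (θ ^ p) ψ := by
  obtain ⟨n, rfl⟩ := Nat.exists_eq_succ_of_ne_zero hp
  have := LinearMap.pow_commutator_of_commutator_eq_one h n
  rw [CharP.cast_eq_zero K, zero_smul, sub_eq_zero] at this
  exact this.symm

/-- The lowering operator `f ↦ (i ↦ (i + 1) f (i + 1))` on functions `ZMod p → ZMod p`. -/
def lowering (p : ℕ) : Module.End (ZMod p) (ZMod p → ZMod p) where
  toFun f i := (i + 1) * f (i + 1)
  map_add' f g := by ext i; simp [mul_add]
  map_smul' r f := by ext i; simp [mul_left_comm]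

@[simp]
theorem lowering_apply (p : ℕ) (f : ZMod p → ZMod p) (i : ZMod p) :
    lowering p f i = (i + 1) * f (i + 1) := rfl

/-- The twisted cyclic shift whose inverse has `p`-th power `a`. -/
def twistedShift {p : ℕ} (a : (ZMod p)ˣ) : (ZMod p → ZMod p) ≃ₗ[ZMod p] (ZMod p → ZMod p) where
  toFun f i := (if i + 1 = 0 then ((a⁻¹ : (ZMod p)ˣ) : ZMod p) else 1) * f (i + 1)
  invFun f i := (if i = 0 then (a : ZMod p) else 1) * f (i - 1)
  map_add' f g := by ext i; simp [mul_add]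
  map_smul' r f := by ext i; simp [mul_left_comm]
  left_inv f := by ext i; by_cases h : i = 0 <;> simp [h]
  right_inv f := by
    ext i
    by_cases h : i + 1 = 0
    · simp [eq_neg_of_add_eq_zero_left h]
    · simp [h]

@[simp]
theorem twistedShift_apply {p : ℕ} (a : (ZMod p)ˣ) (f : ZMod p → ZMod p) (i : ZMod p) :
    twistedShift a f i =
      (if i + 1 = 0 then ((a⁻¹ : (ZMod p)ˣ) : ZMod p) else 1) * f (i + 1) := rfl

@[simp]
theorem twistedShift_symm_apply {p : ℕ} (a : (ZMod p)ˣ) (f : ZMod p → ZMod p) (i : ZMod p) :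
    (twistedShift a).symm f i = (if i = 0 then (a : ZMod p) else 1) * f (i - 1) := rfl

theorem eq_zero_of_lowering_eq_smul {p : ℕ} [Fact p.Prime] {l : ZMod p} (hl : l ≠ 0)
    {f : ZMod p → ZMod p} (h : lowering p f = l • f) : f = 0 := by
  have key : ∀ k : ℕ, f (-1 - k) = 0 := by
    intro k
    have hk := congrFun h (-1 - k)
    simp only [lowering_apply, Pi.smul_apply, smul_eq_mul] at hk
    refine (mul_eq_zero.1 (hk.symm.trans ?_)).resolve_left hl
    induction k with
    | zero => simp
    | succ k ih =>
      have e : (-1 - ((k + 1 : ℕ) : ZMod p) + 1) = -1 - k := by push_cast; ring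
      have hk' := congrFun h (-1 - k)
      simp only [lowering_apply, Pi.smul_apply, smul_eq_mul] at hk'
      rw [e, (mul_eq_zero.1 (hk'.symm.trans (ih hk'))).resolve_left hl, mul_zero]
  ext i
  have := key (-1 - i).val
  rwa [ZMod.natCast_zmod_val, sub_sub_cancel] at this

theorem exists_lowering_eq {p : ℕ} [Fact p.Prime] {w : ZMod p → ZMod p} (hw : w (-1) = 0) :
    ∃ y, lowering p y = w := by
  refine ⟨fun j => w (j - 1) / j, ?_⟩
  ext i
  by_cases hi : i + 1 = 0
  · rw [eq_neg_of_add_eq_zero_left hi, hw]; simp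
  · simp only [lowering_apply, add_sub_cancel_right]
    field_simp

/-- The operator `lowering + b`. -/
noncomputable def loweringAdd {p : ℕ} [Fact p.Prime] (b : (ZMod p)ˣ) :
    (ZMod p → ZMod p) ≃ₗ[ZMod p] (ZMod p → ZMod p) :=
  LinearEquiv.ofInjectiveEndo (lowering p + (b : ZMod p) • 1) <| by
    rw [injective_iff_map_eq_zero]
    intro f hf
    refine eq_zero_of_lowering_eq_smul (l := -(b : ZMod p)) (by simp) ?_
    rw [neg_smul, eq_neg_iff_add_eq_zero]
    simpa using hf

@[simp]
theorem loweringAdd_apply {p : ℕ} [Fact p.Prime] (b : (ZMod p)ˣ) (f : ZMod p → ZMod p) :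
    loweringAdd b f = lowering p f + (b : ZMod p) • f := by
  simp [loweringAdd]

theorem lowering_twistedShift_symm {p : ℕ} (a : (ZMod p)ˣ) (f : ZMod p → ZMod p) :
    lowering p ((twistedShift a).symm f) = (twistedShift a).symm (lowering p f) + f := by
  ext i
  have h1 : lowering p ((twistedShift a).symm f) i = (i + 1) * f i := by
    by_cases hi : i + 1 = 0 <;> simp [hi]
  have h2 : (twistedShift a).symm (lowering p f) i = i * f i := by
    by_cases hi : i = 0 <;> simp [hi]
  rw [h1, Pi.add_apply, h2, add_one_mul]

/-- The relation equivalent to the cycle set law for `x·y = φ x + ψ y + c`. -/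
theorem twistedShift_loweringAdd {p : ℕ} [Fact p.Prime] (a b : (ZMod p)ˣ) (f : ZMod p → ZMod p) :
    twistedShift a (loweringAdd b f) =
      twistedShift a (twistedShift a f) + loweringAdd b (twistedShift a f) := by
  obtain ⟨g, rfl⟩ := (twistedShift a).symm.surjective f
  simp only [loweringAdd_apply, LinearEquiv.apply_symm_apply, lowering_twistedShift_symm, map_add,
    map_smul]
  abel


theorem twistedShift_symm_single {p : ℕ} (a : (ZMod p)ˣ) (j : ZMod p) :
    (twistedShift a).symm (Pi.single j 1) =
      (if j + 1 = 0 then (a : ZMod p) else 1) • Pi.single (j + 1) 1 := by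
  ext i
  by_cases h : i = j + 1
  · subst h; simp
  · have h' : i - 1 ≠ j := fun e => h (by rw [← e]; ring)
    simp [h, h']

theorem lowering_single (p : ℕ) (j : ZMod p) :
    lowering p (Pi.single j 1) = j • Pi.single (j - 1) 1 := by
  ext i
  by_cases h : i + 1 = j
  · subst h; simp
  · have h' : i ≠ j - 1 := fun e => h (by rw [e]; ring)
    simp [h, h']

theorem val_add_one_cases {p : ℕ} [Fact p.Prime] (j : ZMod p) :
    (j + 1 = 0 ∧ j.val + 1 = p) ∨ (j + 1 ≠ 0 ∧ (j + 1).val = j.val + 1) := by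
  have hj : j + 1 = ((j.val + 1 : ℕ) : ZMod p) := by simp
  rcases (Nat.succ_le_of_lt j.val_lt).eq_or_lt with h | h
  · left
    exact ⟨by rw [hj, show j.val + 1 = p from h]; simp, h⟩
  · right
    have hv : (j + 1).val = j.val + 1 := by rw [hj, ZMod.val_natCast_of_lt h]
    exact ⟨fun h0 => by simp [h0] at hv, hv⟩

theorem twistedShift_symm_pow_single_zero {p : ℕ} [Fact p.Prime] (a : (ZMod p)ˣ) :
    (((twistedShift a).symm : Module.End (ZMod p) (ZMod p → ZMod p)) ^ p) (Pi.single 0 1) =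
      (a : ZMod p) • Pi.single 0 1 := by
  have key : ∀ k < p, (((twistedShift a).symm : Module.End (ZMod p) (ZMod p → ZMod p)) ^ k)
      (Pi.single 0 1) = Pi.single (k : ZMod p) 1 := by
    intro k hk
    induction k with
    | zero => simp
    | succ k ih =>
      have hk' : (k : ZMod p) + 1 ≠ 0 := by
        rw [← Nat.cast_succ, Ne, ZMod.natCast_eq_zero_iff]
        exact Nat.not_dvd_of_pos_of_lt k.succ_pos hk
      rw [pow_succ', Module.End.mul_apply, ih (by omega), LinearEquiv.coe_coe,
        twistedShift_symm_single, if_neg hk', one_smul, Nat.cast_succ]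
  obtain ⟨n, hn⟩ := Nat.exists_eq_succ_of_ne_zero (Fact.out : p.Prime).ne_zero
  have hn' : (n : ZMod p) + 1 = 0 := by rw [← Nat.cast_succ, ← hn]; simp
  have hstep : ∀ m, m = n + 1 →
      (((twistedShift a).symm : Module.End (ZMod p) (ZMod p → ZMod p)) ^ m) (Pi.single 0 1) =
      (a : ZMod p) • Pi.single 0 1 := by
    rintro m rfl
    rw [pow_succ', Module.End.mul_apply, key n (by omega), LinearEquiv.coe_coe,
      twistedShift_symm_single, if_pos hn', hn']
  exact hstep p hn

/-- The left quasigroup `x·y = φ x + ψ y + c`. -/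
def affineLQ {K V : Type*} [Semiring K] [AddCommGroup V] [Module K V] (φ ψ : V ≃ₗ[K] V) (c : V)
    (x : V) : Equiv.Perm V :=
  ψ.toEquiv.trans (Equiv.addRight (φ x + c))

@[simp]
theorem affineLQ_apply {K V : Type*} [Semiring K] [AddCommGroup V] [Module K V] (φ ψ : V ≃ₗ[K] V)
    (c x y : V) : affineLQ φ ψ c x y = φ x + ψ y + c := by
  simp [affineLQ]; abel

/-- Isomorphism of left quasigroups. -/
def IsoLQ {X Y : Type*} (σ : X → Equiv.Perm X) (τ : Y → Equiv.Perm Y) : Prop :=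
  ∃ f : X ≃ Y, ∀ x y, f (σ x y) = τ (f x) (f y)

theorem IsoLQ.refl {X : Type*} (σ : X → Equiv.Perm X) : IsoLQ σ σ := ⟨Equiv.refl X, by simp⟩

theorem IsoLQ.symm {X Y : Type*} {σ : X → Equiv.Perm X} {τ : Y → Equiv.Perm Y}
    (h : IsoLQ σ τ) : IsoLQ τ σ := by
  obtain ⟨f, hf⟩ := h
  exact ⟨f.symm, fun x y => by rw [Equiv.symm_apply_eq, hf]; simp⟩

theorem IsoLQ.trans {X Y Z : Type*} {σ : X → Equiv.Perm X} {τ : Y → Equiv.Perm Y}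
    {υ : Z → Equiv.Perm Z} (h : IsoLQ σ τ) (h' : IsoLQ τ υ) : IsoLQ σ υ := by
  obtain ⟨f, hf⟩ := h
  obtain ⟨g, hg⟩ := h'
  exact ⟨f.trans g, fun x y => by simp [hf, hg]⟩

/-- Simple latin affine non-degenerate cycle sets. -/
def IsSimpleLatinAffine {X : Type*} (σ : X → Equiv.Perm X) : Prop :=
  CycleSetLaw σ ∧ Nondeg σ ∧ LatinLQ σ ∧ IsAffine σ ∧ SimpleLQ σ

/-- The left quasigroup structure transported along a bijection. -/
def transportLQ {X Y : Type*} (e : X ≃ Y) (σ : X → Equiv.Perm X) (y : Y) : Equiv.Perm Y :=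
  e.permCongr (σ (e.symm y))

@[simp]
theorem transportLQ_apply {X Y : Type*} (e : X ≃ Y) (σ : X → Equiv.Perm X) (x y : Y) :
    transportLQ e σ x y = e (σ (e.symm x) (e.symm y)) := rfl

@[simp]
theorem transportLQ_symm_apply {X Y : Type*} (e : X ≃ Y) (σ : X → Equiv.Perm X) (x y : Y) :
    (transportLQ e σ x).symm y = e ((σ (e.symm x)).symm (e.symm y)) := rfl

theorem isoLQ_transportLQ {X Y : Type*} (e : X ≃ Y) (σ : X → Equiv.Perm X) :
    IsoLQ σ (transportLQ e σ) := ⟨e, by simp⟩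

theorem IsSimpleLatinAffine.transportLQ {X Y : Type*} (e : X ≃ Y) {σ : X → Equiv.Perm X}
    (h : IsSimpleLatinAffine σ) : IsSimpleLatinAffine (transportLQ e σ) := by
  obtain ⟨hc, hn, hl, ⟨inst, φ, ψ, c, hφ, hψ, hφa, hψa, hσ⟩, hi, hs⟩ := h
  refine ⟨fun x y z => ?_, ?_, fun x => ?_, ?_, ?_, fun r hr => ?_⟩
  · simp [hc (e.symm x) (e.symm y) (e.symm z)]
  · exact e.bijective.comp (hn.comp e.symm.bijective)
  · exact e.bijective.comp ((hl (e.symm x)).comp e.symm.bijective)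
  · refine ⟨e.symm.addCommGroup, e ∘ φ ∘ e.symm, e ∘ ψ ∘ e.symm, e c,
      e.bijective.comp (hφ.comp e.symm.bijective), e.bijective.comp (hψ.comp e.symm.bijective),
      fun a b => ?_, fun a b => ?_, fun x y => ?_⟩ <;>
    simp [Equiv.add_def, hφa, hψa, hσ]
  · intro x y
    obtain ⟨z, hz⟩ : ∃ z, σ z (e.symm x) = e.symm y := (hl _).2 _
    exact ⟨_, Subgroup.subset_closure ⟨e z, rfl⟩, by simp [hz]⟩
  · obtain ⟨heq, h1, h2⟩ := hr
    refine (hs (fun x y => r (e x) (e y)) ⟨⟨fun x => heq.refl _, heq.symm, heq.trans⟩,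
      fun x x' y y' hx hy => ?_, fun x x' y y' hx hy => ?_⟩).imp (fun H a b => ?_) fun H a b => ?_
    · simpa using h1 _ _ _ _ hx hy
    · simpa using h2 _ _ _ _ hx hy
    · simpa using H (e.symm a) (e.symm b)
    · simpa using H (e.symm a) (e.symm b)

theorem LinearEquiv.commutator_symm_eq_one {K V : Type*} [Field K] [AddCommGroup V] [Module K V]
    {φ ψ : V ≃ₗ[K] V} (h : ∀ x, φ (ψ x) = φ (φ x) + ψ (φ x)) :
    (ψ * φ.symm - φ.symm * ψ : Module.End K V) = 1 := by
  ext x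
  have := congrArg φ.symm (h (φ.symm x))
  simp only [LinearEquiv.apply_symm_apply, LinearEquiv.symm_apply_apply, map_add] at this
  simp [this]

theorem isSimpleLatinAffine_affineLQ {p : ℕ} [Fact p.Prime] {V : Type*} [AddCommGroup V]
    [Module (ZMod p) V] [FiniteDimensional (ZMod p) V] (hV : Module.finrank (ZMod p) V = p)
    {φ ψ : V ≃ₗ[ZMod p] V} (h : ∀ x, φ (ψ x) = φ (φ x) + ψ (φ x)) (c : V) :
    IsSimpleLatinAffine (affineLQ φ ψ c) := by
  refine ⟨fun x y z => ?_, ?_, fun x => ?_, ?_, fun x y => ?_, fun r hr => ?_⟩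
  · simp only [affineLQ_apply, map_add, h]
    abel
  · have e : (fun x => affineLQ φ ψ c x x) = fun x => φ (ψ (φ.symm x)) + c := by
      ext x
      simp [h]
    rw [Nondeg, e]
    exact (Equiv.addRight c).bijective.comp
      (φ.bijective.comp (ψ.bijective.comp φ.symm.bijective))
  · have e : (fun y => affineLQ φ ψ c y x) = fun y => φ y + (ψ x + c) := by
      ext y
      simp [add_assoc]
    rw [e]
    exact (Equiv.addRight (ψ x + c)).bijective.comp φ.bijective
  · exact ⟨inferInstance, φ, ψ, c, φ.bijective, ψ.bijective, map_add φ, map_add ψ, by simp⟩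
  · exact ⟨_, Subgroup.subset_closure ⟨φ.symm (y - ψ x - c), rfl⟩, by simp; abel⟩
  · obtain ⟨heq, h1, h2⟩ := hr
    have htrans : ∀ t x y, r x y → r (x + t) (y + t) := by
      intro t x y hxy
      have := h1 _ _ _ _ (heq.refl (φ.symm t)) (h2 _ _ _ _ (heq.refl 0) hxy)
      have e : ∀ x, affineLQ φ ψ c (φ.symm t) ((affineLQ φ ψ c 0).symm x) = x + t := by
        intro x
        obtain ⟨y, rfl⟩ := (affineLQ φ ψ c 0).surjective x
        rw [Equiv.symm_apply_apply]
        simp; abel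
      rwa [e, e] at this
    let H : AddSubgroup V :=
      { carrier := {x | r x 0}
        zero_mem' := heq.refl 0
        add_mem' := fun {x y} hx hy => heq.trans (htrans y x 0 hx) (by simpa using hy)
        neg_mem' := fun {x} hx => heq.symm (by simpa using htrans (-x) x 0 hx) }
    let W : Submodule (ZMod p) V := AddSubgroup.toZModSubmodule p H
    have hmem : ∀ x, x ∈ W ↔ r x 0 := fun x => Iff.rfl
    have hiff : ∀ x y, r x y ↔ x - y ∈ W := by
      intro x y
      rw [hmem]
      refine ⟨fun hxy => by simpa [sub_eq_add_neg] using htrans (-y) x y hxy, fun hxy => ?_⟩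
      simpa using htrans y _ _ hxy
    have hφ : ∀ x ∈ W, φ x ∈ W := by
      intro x hx
      have := (hiff _ _).1 (h1 _ _ _ _ hx (heq.refl 0))
      simpa using this
    have hψ : ∀ x ∈ W, ψ x ∈ W := by
      intro x hx
      have := (hiff _ _).1 (h1 _ _ _ _ (heq.refl 0) hx)
      simpa using this
    have hθ : ∀ x ∈ W, φ.symm x ∈ W := by
      have hinj : Function.Injective ((φ : Module.End (ZMod p) V).restrict hφ) := by
        intro x y hxy
        exact Subtype.ext (φ.injective (congrArg Subtype.val hxy))
      intro x hx
      obtain ⟨y, hy⟩ := LinearMap.surjective_of_injective hinj ⟨x, hx⟩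
      have : φ y = x := congrArg Subtype.val hy
      rw [← this, LinearEquiv.symm_apply_apply]
      exact y.2
    by_cases hW : W = ⊥
    · left
      intro a b
      rw [hiff, hW, Submodule.mem_bot, sub_eq_zero]
    · right
      intro a b
      rw [hiff, LinearMap.eq_top_of_commutator_eq_one hV
        (LinearEquiv.commutator_symm_eq_one h) hθ hψ hW]
      trivial

theorem exists_equiv_twistedShift_loweringAdd {p : ℕ} [Fact p.Prime] {V : Type*} [AddCommGroup V]
    [Module (ZMod p) V] [FiniteDimensional (ZMod p) V] (hV : Module.finrank (ZMod p) V = p)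
    {φ ψ : V ≃ₗ[ZMod p] V} (h : ∀ x, φ (ψ x) = φ (φ x) + ψ (φ x)) :
    ∃ (a b : (ZMod p)ˣ) (g : V ≃ₗ[ZMod p] (ZMod p → ZMod p)),
      (∀ x, g (φ x) = twistedShift a (g x)) ∧ ∀ x, g (ψ x) = loweringAdd b (g x) := by
  have hp : p ≠ 0 := (Fact.out : p.Prime).ne_zero
  have hnt : Nontrivial V := Module.nontrivial_of_finrank_pos (R := ZMod p) (by omega)
  let θ : Module.End (ZMod p) V := φ.symm
  let ψ' : Module.End (ZMod p) V := ψ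
  have hcomm : ψ' * θ - θ * ψ' = 1 := LinearEquiv.commutator_symm_eq_one h
  have hcomm' : -θ * ψ' - ψ' * -θ = 1 := by rw [← hcomm]; noncomm_ring
  obtain ⟨a, ha⟩ := LinearMap.eq_smul_one_of_commutator_eq_one hp hV hcomm
    (Commute.pow_self θ p) (LinearMap.commute_pow_char_of_commutator_eq_one hp hcomm)
  obtain ⟨b, hb⟩ := LinearMap.eq_smul_one_of_commutator_eq_one hp hV hcomm
    (by simpa using LinearMap.commute_pow_char_of_commutator_eq_one hp hcomm')
    (Commute.pow_self ψ' p)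
  have hunit : ∀ (χ : V ≃ₗ[ZMod p] V) (a : ZMod p),
      (χ : Module.End (ZMod p) V) ^ p = a • 1 → a ≠ 0 := by
    rintro χ a hχ rfl
    obtain ⟨x, hx⟩ := exists_ne (0 : V)
    have hinj : Function.Injective ((χ : Module.End (ZMod p) V) ^ p) := by
      rw [Module.End.coe_pow]
      exact χ.injective.iterate p
    exact hx (hinj (by simp [hχ]))
  have ha0 : a ≠ 0 := hunit φ.symm a ha
  have hb0 : b ≠ 0 := hunit ψ b hb
  obtain ⟨v, hv0, hv⟩ : ∃ v, v ≠ 0 ∧ ψ v = b • v := by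
    have : CharP (Module.End (ZMod p) V) p :=
      charP_of_injective_algebraMap (algebraMap (ZMod p) (Module.End (ZMod p) V)).injective p
    have hnil : (ψ' - b • 1 : Module.End (ZMod p) V) ^ p = 0 := by
      rw [sub_pow_char_of_commute p ((Commute.one_right ψ').smul_right b), hb, smul_pow, one_pow,
        ZMod.pow_card, sub_self]
    have hninj : ¬ Function.Injective (ψ' - b • 1 : Module.End (ZMod p) V) := by
      intro hinj
      obtain ⟨x, hx⟩ := exists_ne (0 : V)
      have := hinj.iterate p
      rw [← Module.End.coe_pow, hnil] at this
      exact hx (this (by simp))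
    rw [injective_iff_map_eq_zero] at hninj
    push Not at hninj
    obtain ⟨v, hv, hv0⟩ := hninj
    refine ⟨v, hv0, ?_⟩
    rw [← sub_eq_zero]
    exact hv
  let u : ZMod p → V := fun i => (θ ^ i.val) v
  have huθ : ∀ j, φ.symm (u j) = (if j + 1 = 0 then a else 1) • u (j + 1) := by
    intro j
    have e : φ.symm (u j) = (θ ^ (j.val + 1)) v := by
      rw [pow_succ', Module.End.mul_apply]; rfl
    rw [e]
    rcases val_add_one_cases j with ⟨h0, hj⟩ | ⟨h0, hj⟩
    · simp [u, h0, hj, ha]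
    · simp [u, h0, hj]
  have huψ : ∀ j, ψ (u j) = b • u j + j • u (j - 1) := by
    intro j
    obtain ⟨i, rfl⟩ : ∃ i, j = i + 1 := ⟨j - 1, by ring⟩
    rcases val_add_one_cases i with ⟨h0, hj⟩ | ⟨h0, hj⟩
    · simp [u, h0, hv]
    · have := LinearMap.congr_fun (LinearMap.pow_commutator_of_commutator_eq_one hcomm i.val) v
      simp only [LinearMap.sub_apply, Module.End.mul_apply, LinearMap.smul_apply] at this
      rw [sub_eq_iff_eq_add', show ψ' v = b • v from hv, map_smul] at this
      rw [add_sub_cancel_right]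
      simp only [u, hj]
      refine Eq.trans this ?_
      simp
  let G : (ZMod p → ZMod p) →ₗ[ZMod p] V := Fintype.linearCombination (ZMod p) u
  have hGs : ∀ j, G (Pi.single j 1) = u j := fun j => by
    simp [G, Fintype.linearCombination_apply_single]
  have hGθ : ∀ f, G ((twistedShift (Units.mk0 a ha0)).symm f) = φ.symm (G f) := by
    intro f
    refine LinearMap.congr_fun (f := G ∘ₗ (twistedShift (Units.mk0 a ha0)).symm.toLinearMap)
      (g := φ.symm.toLinearMap ∘ₗ G) ?_ f
    refine LinearMap.pi_ext' fun j => LinearMap.ext_ring ?_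
    by_cases hj : j + 1 = 0 <;> simp [hGs, huθ, twistedShift_symm_single, hj]
  have hGψ : ∀ f, G (loweringAdd (Units.mk0 b hb0) f) = ψ (G f) := by
    intro f
    refine LinearMap.congr_fun (f := G ∘ₗ (loweringAdd (Units.mk0 b hb0)).toLinearMap)
      (g := ψ.toLinearMap ∘ₗ G) ?_ f
    refine LinearMap.pi_ext' fun j => LinearMap.ext_ring ?_
    simp [hGs, huψ, lowering_single, add_comm]
  have hsurj : Function.Surjective G := by
    rw [← LinearMap.range_eq_top]
    refine LinearMap.eq_top_of_commutator_eq_one hV hcomm ?_ ?_ ?_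
    · rintro _ ⟨f, rfl⟩
      exact ⟨_, hGθ f⟩
    · rintro _ ⟨f, rfl⟩
      exact ⟨_, hGψ f⟩
    · intro hbot
      have : u 0 ∈ LinearMap.range G := ⟨_, hGs 0⟩
      rw [hbot] at this
      exact hv0 (by simpa [u] using this)
  have hinj : Function.Injective G :=
    (LinearMap.injective_iff_surjective_of_finrank_eq_finrank (by simp [hV])).2 hsurj
  let g := (LinearEquiv.ofBijective G ⟨hinj, hsurj⟩).symm
  have hg : ∀ x, G (g x) = x := fun x => (LinearEquiv.ofBijective G ⟨hinj, hsurj⟩).apply_symm_apply x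
  refine ⟨Units.mk0 a ha0, Units.mk0 b hb0, g, fun x => ?_, fun x => ?_⟩
  · rw [← LinearEquiv.symm_apply_eq]
    apply hinj
    rw [hGθ, hg, hg, LinearEquiv.symm_apply_apply]
  · apply hinj
    rw [hGψ, hg, hg]

/-- The affine cycle set on `ZMod p → ZMod p` given by a twisted shift, a lowering operator and
a constant. -/
noncomputable def modelLQ {p : ℕ} [Fact p.Prime] (a b : (ZMod p)ˣ) (c : ZMod p → ZMod p) :
    (ZMod p → ZMod p) → Equiv.Perm (ZMod p → ZMod p) :=
  affineLQ (twistedShift a) (loweringAdd b) c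

@[simp]
theorem modelLQ_apply {p : ℕ} [Fact p.Prime] (a b : (ZMod p)ˣ) (c x y : ZMod p → ZMod p) :
    modelLQ a b c x y = twistedShift a x + loweringAdd b y + c := affineLQ_apply _ _ _ _ _

theorem isSimpleLatinAffine_modelLQ {p : ℕ} [Fact p.Prime] (a b : (ZMod p)ˣ)
    (c : ZMod p → ZMod p) : IsSimpleLatinAffine (modelLQ a b c) :=
  isSimpleLatinAffine_affineLQ (by simp) (twistedShift_loweringAdd a b) c

theorem exists_isoLQ_modelLQ_of_addMonoidHom {p : ℕ} [Fact p.Prime] {V : Type*} [AddCommGroup V]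
    [Module (ZMod p) V] (hV : Nat.card V = p ^ p) {φ₀ ψ₀ : V →+ V} (hφ : Function.Bijective φ₀)
    (hψ : Function.Bijective ψ₀) {c : V} {σ : V → Equiv.Perm V} (hc : CycleSetLaw σ)
    (hσ : ∀ x y, σ x y = φ₀ x + ψ₀ y + c) : ∃ a b c, IsoLQ σ (modelLQ (p := p) a b c) := by
  have hp : p.Prime := Fact.out
  have hfin : Finite V := Nat.finite_of_card_ne_zero (by simp [hV, hp.ne_zero])
  have hrank : Module.finrank (ZMod p) V = p :=
    Nat.pow_right_injective hp.two_le ((FiniteField.pow_finrank_eq_natCard p V).trans hV)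
  let φ : V ≃ₗ[ZMod p] V := LinearEquiv.ofBijective (φ₀.toZModLinearMap p) hφ
  let ψ : V ≃ₗ[ZMod p] V := LinearEquiv.ofBijective (ψ₀.toZModLinearMap p) hψ
  replace hσ : ∀ x y, σ x y = φ x + ψ y + c := hσ
  have hrel : ∀ x, φ (ψ x) = φ (φ x) + ψ (φ x) := by
    intro x
    have := hc 0 x 0
    simp only [hσ, map_add, map_zero, add_zero, zero_add] at this
    apply add_right_cancel (b := φ c + ψ c + c)
    calc _ = φ (ψ x) + φ c + ψ c + c := by abel
      _ = _ := this
      _ = _ := by abel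
  obtain ⟨a, b, g, hgφ, hgψ⟩ := exists_equiv_twistedShift_loweringAdd hrank hrel
  exact ⟨a, b, g c, g.toEquiv, fun x y => by simp [hσ, hgφ, hgψ]⟩

theorem IsSimpleLatinAffine.exists_isoLQ_modelLQ {p : ℕ} [Fact p.Prime] {X : Type*}
    (hX : Nat.card X = p ^ p) {σ : X → Equiv.Perm X} (h : IsSimpleLatinAffine σ) :
    ∃ a b c, IsoLQ σ (modelLQ (p := p) a b c) := by
  obtain ⟨hc, -, -, ⟨inst, φ, ψ, c, hφ, hψ, hφa, hψa, hσ⟩, -, hs⟩ := h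
  have hp : p.Prime := Fact.out
  have hfin : Finite X := Nat.finite_of_card_ne_zero (by simp [hX, hp.ne_zero])
  let φ₀ : X →+ X := AddMonoidHom.mk' φ hφa
  let ψ₀ : X →+ X := AddMonoidHom.mk' ψ hψa
  have hφp : ∀ x, φ (p • x) = p • φ x := map_nsmul φ₀ p
  have hψp : ∀ x, ψ (p • x) = p • ψ x := map_nsmul ψ₀ p
  have htors : ∀ x : X, p • x = 0 := by
    have hcong : IsCongruence σ fun x y => p • x = p • y := by
      refine ⟨⟨fun _ => rfl, Eq.symm, Eq.trans⟩, fun x x' y y' hx hy => ?_,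
        fun x x' y y' hx hy => ?_⟩
      · simp only [hσ, nsmul_add, ← hφp, ← hψp, hx, hy]
      · obtain ⟨z, rfl⟩ := (σ x).surjective y
        obtain ⟨z', rfl⟩ := (σ x').surjective y'
        simp only [Equiv.symm_apply_apply]
        simp only [hσ, nsmul_add, ← hφp, ← hψp, hx] at hy
        exact hψ.1 (add_left_cancel (add_right_cancel hy))
    rcases hs _ hcong with H | H
    · have hdvd : p ∣ Nat.card X := hX ▸ dvd_pow_self p hp.ne_zero
      obtain ⟨x, hx⟩ := exists_prime_addOrderOf_dvd_card' p hdvd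
      have hx0 : x = 0 := (H x 0).1 (by rw [← hx, addOrderOf_nsmul_eq_zero, nsmul_zero])
      rw [hx0, addOrderOf_zero] at hx
      exact absurd hx.symm hp.one_lt.ne'
    · intro x
      simpa using H x 0
  have hmod : Module (ZMod p) X := AddCommGroup.zmodModule htors
  exact exists_isoLQ_modelLQ_of_addMonoidHom (φ₀ := φ₀) (ψ₀ := ψ₀) hX hφ hψ hc hσ

theorem exists_idempotent_iff {p : ℕ} [Fact p.Prime] (a : (ZMod p)ˣ) (c : ZMod p → ZMod p) :
    (∃ x, x = twistedShift a x + loweringAdd 1 x + c) ↔ c (-2) = 0 := by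
  have h1 : (-1 : ZMod p) ≠ 0 := by simp
  have h2 : (-2 : ZMod p) + 1 = -1 := by ring
  have h3 : (-1 : ZMod p) - 1 = -2 := by ring
  have hx : ∀ y, twistedShift a (twistedShift a y) + loweringAdd 1 (twistedShift a y) =
      twistedShift a (lowering p y) + twistedShift a y := by
    intro y
    rw [← twistedShift_loweringAdd]
    simp
  constructor
  · rintro ⟨x, h⟩
    obtain ⟨y, rfl⟩ := (twistedShift a).surjective x
    rw [hx, add_right_comm, eq_comm, add_eq_right] at h
    have := congrFun h (-2)
    simpa [h1, h2] using this
  · intro h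
    obtain ⟨y, hy⟩ := exists_lowering_eq (w := -(twistedShift a).symm c)
      (by simp [h3, h])
    refine ⟨twistedShift a y, ?_⟩
    rw [hx, hy, map_neg, LinearEquiv.apply_symm_apply]
    abel

theorem isoLQ_modelLQ_translate {p : ℕ} [Fact p.Prime] (a b : (ZMod p)ˣ) (c t : ZMod p → ZMod p)
    (k : (ZMod p)ˣ) :
    IsoLQ (modelLQ a b c)
      (modelLQ a b ((k : ZMod p) • c + t - twistedShift a t - loweringAdd b t)) := by
  refine ⟨(LinearEquiv.smulOfUnit k).toEquiv.trans (Equiv.addRight t), fun x y => ?_⟩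
  have e : ∀ x : ZMod p → ZMod p, LinearEquiv.smulOfUnit k x = (k : ZMod p) • x := fun x => rfl
  simp only [modelLQ_apply, Equiv.trans_apply, LinearEquiv.coe_toEquiv, Equiv.coe_addRight, e,
    map_add, smul_add, map_smul]
  abel

/-- Representatives of the isomorphism classes: `some b` stands for the constant `0`, and `none`
for `b = 1` with a constant that cannot be translated to `0`. -/
noncomputable def representative {p : ℕ} [Fact p.Prime] (i : (ZMod p)ˣ × Option (ZMod p)ˣ) :
    (ZMod p → ZMod p) → Equiv.Perm (ZMod p → ZMod p) :=
  modelLQ i.1 (i.2.getD 1) (if i.2 = none then Pi.single (-2) 1 else 0)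

theorem exists_isoLQ_representative {p : ℕ} [Fact p.Prime] (a b : (ZMod p)ˣ)
    (c : ZMod p → ZMod p) :
    ∃ i : (ZMod p)ˣ × Option (ZMod p)ˣ, IsoLQ (modelLQ a b c) (representative i) := by
  by_cases hfix : ∃ x, x = twistedShift a x + loweringAdd b x + c
  · obtain ⟨x, hx⟩ := hfix
    refine ⟨(a, some b), ?_⟩
    have hc : ((1 : (ZMod p)ˣ) : ZMod p) • c + -x - twistedShift a (-x) - loweringAdd b (-x) = 0 := by
      rw [Units.val_one, one_smul, map_neg, map_neg]
      nth_rw 1 [hx]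
      abel
    have := isoLQ_modelLQ_translate a b c (-x) 1
    rw [hc] at this
    simpa [representative] using this
  by_cases hb : b = 1
  · subst hb
    rw [exists_idempotent_iff] at hfix
    refine ⟨(a, none), ?_⟩
    obtain ⟨t, ht⟩ := (exists_idempotent_iff a ((c (-2))⁻¹ • c - Pi.single (-2) 1)).2
      (by simp [hfix])
    have hc : (((Units.mk0 _ hfix)⁻¹ : (ZMod p)ˣ) : ZMod p) • c + -t - twistedShift a (-t) -
        loweringAdd 1 (-t) = Pi.single (-2) 1 := by
      rw [Units.val_inv_eq_inv_val, Units.val_mk0, map_neg, map_neg]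
      nth_rw 1 [ht]
      abel
    have := isoLQ_modelLQ_translate a 1 c (-t) (Units.mk0 _ hfix)⁻¹
    rw [hc] at this
    simpa [representative] using this
  · have hinj : Function.Injective (1 - (twistedShift a).toLinearMap - (loweringAdd b).toLinearMap :
        Module.End (ZMod p) (ZMod p → ZMod p)) := by
      rw [injective_iff_map_eq_zero]
      intro x hx
      obtain ⟨y, rfl⟩ := (twistedShift a).surjective x
      have hy : y = loweringAdd b y := by
        apply (twistedShift a).injective
        rw [twistedShift_loweringAdd]
        refine sub_eq_zero.1 ?_
        rw [← sub_sub]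
        exact hx
      have hb' : (1 : ZMod p) - b ≠ 0 := sub_ne_zero.2 fun e => hb (Units.ext e.symm)
      rw [loweringAdd_apply, ← sub_eq_iff_eq_add] at hy
      have hy0 : y = 0 :=
        eq_zero_of_lowering_eq_smul hb' (by rw [← hy, sub_smul, one_smul])
      rw [hy0, map_zero]
    obtain ⟨x, hx⟩ := LinearMap.surjective_of_injective hinj c
    refine absurd ⟨x, ?_⟩ hfix
    rw [← hx]
    simp only [LinearMap.sub_apply, Module.End.one_apply, LinearEquiv.coe_coe]
    abel

theorem IsoLQ.exists_addHom {V W : Type*} [AddCommGroup V] [AddCommGroup W] {K : Type*}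
    [Semiring K] [Module K V] [Module K W] {φ ψ : V ≃ₗ[K] V} {φ' ψ' : W ≃ₗ[K] W} {c : V} {c' : W}
    (h : IsoLQ (affineLQ φ ψ c) (affineLQ φ' ψ' c')) :
    ∃ g : V →+ W, Function.Injective g ∧ (∀ x, g (φ x) = φ' (g x)) ∧
      ∀ x, g (ψ x) = ψ' (g x) := by
  obtain ⟨f, hf⟩ := h
  simp only [affineLQ_apply] at hf
  have hφ : ∀ x, f (φ x) = φ' (f x) + (ψ' (f (ψ.symm (-c))) + c') := by
    intro x
    have := hf x (ψ.symm (-c))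
    simpa [add_assoc] using this
  have hψ : ∀ y, f (ψ y) = ψ' (f y) + (φ' (f (φ.symm (-c))) + c') := by
    intro y
    have := hf (φ.symm (-c)) y
    rw [LinearEquiv.apply_symm_apply, neg_add_cancel_comm] at this
    rw [this]
    abel
  have hadd : ∀ x y, f (x + y) - f 0 = (f x - f 0) + (f y - f 0) := by
    intro x y
    have key : ∀ x y, f (x + y) = φ' (f (φ.symm x)) + ψ' (f (ψ.symm (y - c))) + c' := by
      intro x y
      rw [← hf]
      simp [add_assoc]
    have h1 := key x y
    have h2 := key x 0
    have h3 := key 0 y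
    have h4 := key 0 0
    rw [add_zero] at h2 h4
    rw [zero_add] at h3
    rw [h1, h2, h3, h4]
    abel
  refine ⟨AddMonoidHom.mk' (fun x => f x - f 0) hadd, fun x y hxy => ?_, fun x => ?_, fun x => ?_⟩
  · simpa using hxy
  · have h0 := hφ 0
    rw [map_zero] at h0
    simp only [AddMonoidHom.mk'_apply, map_sub]
    rw [hφ, sub_eq_sub_iff_add_eq_add]
    nth_rw 2 [h0]
    abel
  · have h0 := hψ 0
    rw [map_zero] at h0
    simp only [AddMonoidHom.mk'_apply, map_sub]
    rw [hψ, sub_eq_sub_iff_add_eq_add]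
    nth_rw 2 [h0]
    abel

theorem IsoLQ.modelLQ_params_eq {p : ℕ} [Fact p.Prime] {a b a' b' : (ZMod p)ˣ}
    {c c' : ZMod p → ZMod p} (h : IsoLQ (modelLQ a b c) (modelLQ a' b' c')) :
    a = a' ∧ b = b' := by
  obtain ⟨g, hinj, hgφ, hgψ⟩ := IsoLQ.exists_addHom h
  have hsmul : ∀ (r : ZMod p) x, g (r • x) = r • g x := (g.toZModLinearMap p).map_smul
  set w := g (Pi.single 0 1) with hw
  have hw0 : w ≠ 0 := by
    rw [hw, Ne, map_eq_zero_iff g hinj]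
    simp
  have hlow : lowering p w = ((b : ZMod p) - b') • w := by
    have := hgψ (Pi.single 0 1)
    rw [loweringAdd_apply, loweringAdd_apply, lowering_single, zero_smul, zero_add, hsmul,
      ← hw] at this
    rw [sub_smul, this, add_sub_cancel_right]
  have hb : b = b' := by
    by_contra hne
    exact hw0 (eq_zero_of_lowering_eq_smul (sub_ne_zero.2 (Units.val_injective.ne hne)) hlow)
  have hsingle : w = w 0 • Pi.single 0 1 := by
    ext i
    by_cases hi : i = 0
    · simp [hi]
    · have := congrFun hlow (i - 1)
      simpa [hb, hi] using this
  have hw00 : w 0 ≠ 0 := fun h0 => hw0 (by rw [hsingle, h0, zero_smul])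
  have hpow : ∀ (n : ℕ) x,
      g ((((twistedShift a).symm : Module.End (ZMod p) (ZMod p → ZMod p)) ^ n) x) =
      (((twistedShift a').symm : Module.End (ZMod p) (ZMod p → ZMod p)) ^ n) (g x) := by
    intro n
    induction n with
    | zero => simp
    | succ n ih =>
      intro x
      rw [pow_succ', pow_succ', Module.End.mul_apply, Module.End.mul_apply, ← ih,
        LinearEquiv.coe_coe, LinearEquiv.coe_coe, LinearEquiv.eq_symm_apply, ← hgφ,
        LinearEquiv.apply_symm_apply]
  have ha := hpow p (Pi.single 0 1)
  rw [twistedShift_symm_pow_single_zero, hsmul, ← hw, hsingle, map_smul,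
    twistedShift_symm_pow_single_zero] at ha
  refine ⟨Units.ext ?_, hb⟩
  have := congrFun ha 0
  simp only [Pi.smul_apply, Pi.single_eq_same, smul_eq_mul, mul_one] at this
  rw [mul_comm] at this
  exact mul_left_cancel₀ hw00 this

theorem IsoLQ.eq_of_representative {p : ℕ} [Fact p.Prime]
    {i j : (ZMod p)ˣ × Option (ZMod p)ˣ} (h : IsoLQ (representative i) (representative j)) :
    i = j := by
  have hnone : ∀ a b : (ZMod p)ˣ,
      ¬ IsoLQ (representative (a, none)) (representative (a, some b)) := by
    intro a b hab
    obtain ⟨f, hf⟩ := hab.symm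
    have h0 := hf 0 0
    simp only [representative, modelLQ_apply, map_zero] at h0
    have := (exists_idempotent_iff a (Pi.single (-2) 1)).1 ⟨f 0, by simpa using h0⟩
    simp at this
  obtain ⟨a, o⟩ := i
  obtain ⟨a', o'⟩ := j
  obtain ⟨ha, hb⟩ := IsoLQ.modelLQ_params_eq h
  simp only at ha hb
  subst ha
  rcases o with - | b <;> rcases o' with - | b'
  · rfl
  · exact absurd h (hnone a b')
  · exact absurd h.symm (hnone a b)
  · simpa using hb

/-- for every prime `p`, the number of isomorphism classes of finite
simple latin affine non-degenerate cycle sets of cardinality `p^p` is exactly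
`p(p−1)`.  (Every such cycle set lives, up to isomorphism, on the carrier
`Fin (p^p)`, so we count structures on this carrier modulo isomorphism.) -/
theorem stmt_19 (p : ℕ) (hp : p.Prime) :
    Nat.card (Quot (fun σ τ : {σ : Fin (p ^ p) → Equiv.Perm (Fin (p ^ p)) //
        CycleSetLaw σ ∧ Nondeg σ ∧ LatinLQ σ ∧ IsAffine σ ∧ SimpleLQ σ} =>
      ∃ f : Equiv.Perm (Fin (p ^ p)), ∀ x y : Fin (p ^ p),
        f (σ.1 x y) = τ.1 (f x) (f y))) = p * (p - 1) := by
  have : Fact p.Prime := ⟨hp⟩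
  let e : (ZMod p → ZMod p) ≃ Fin (p ^ p) := Fintype.equivFinOfCardEq (by simp)
  have hequiv : Equivalence (fun σ τ : {σ : Fin (p ^ p) → Equiv.Perm (Fin (p ^ p)) //
      CycleSetLaw σ ∧ Nondeg σ ∧ LatinLQ σ ∧ IsAffine σ ∧ SimpleLQ σ} => IsoLQ σ.1 τ.1) :=
    ⟨fun σ => IsoLQ.refl σ.1, IsoLQ.symm, IsoLQ.trans⟩
  let F (i : (ZMod p)ˣ × Option (ZMod p)ˣ) : {σ : Fin (p ^ p) → Equiv.Perm (Fin (p ^ p)) //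
      CycleSetLaw σ ∧ Nondeg σ ∧ LatinLQ σ ∧ IsAffine σ ∧ SimpleLQ σ} :=
    ⟨transportLQ e (representative i), (isSimpleLatinAffine_modelLQ _ _ _).transportLQ e⟩
  have hF : ∀ i, IsoLQ (representative i) (F i).1 := fun i => isoLQ_transportLQ e _
  have hbij : Function.Bijective fun i => Quot.mk (fun σ τ : {σ : Fin (p ^ p) →
      Equiv.Perm (Fin (p ^ p)) // CycleSetLaw σ ∧ Nondeg σ ∧ LatinLQ σ ∧ IsAffine σ ∧
        SimpleLQ σ} => IsoLQ σ.1 τ.1) (F i) := by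
    constructor
    · intro i j hij
      have hij' : IsoLQ (F i).1 (F j).1 := hequiv.eqvGen_iff.1 (Quot.eqvGen_exact hij)
      exact IsoLQ.eq_of_representative (((hF i).trans hij').trans (hF j).symm)
    · rintro ⟨σ⟩
      obtain ⟨a, b, c, hσ⟩ := IsSimpleLatinAffine.exists_isoLQ_modelLQ (p := p) (by simp) σ.2
      obtain ⟨i, hi⟩ := exists_isoLQ_representative a b c
      exact ⟨i, Quot.sound ((hσ.trans hi).trans (hF i)).symm⟩
  refine (Nat.card_eq_of_bijective _ hbij).symm.trans ?_
  rw [Nat.card_prod, Nat.card_eq_fintype_card, Nat.card_eq_fintype_card, Fintype.card_option,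
    ZMod.card_units, Nat.sub_add_cancel hp.one_le, mul_comm]
end
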